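/- For an ergodic dynamical system (X, T, μ), for every grid θ and every q ≠ 1, the scaling exponents of the enhanced return time box partition function Ψ_τ(θ,ε,q) coincide with the generalized return time dimensions: limsup_{ε→0} (1/(q-1))·log Ψ_τ(θ,ε,q)/log ε = D_τ^+(q) and liminf_{ε→0} (1/(q-1))·log Ψ_τ(θ,ε,q)/log ε = D_τ^-(q), independently of the grid θ. -/

import Mathlib

open MeasureTheory Filter Set
open scoped ENNReal Topology NNReal

noncomputable section

/-- First return time of `x` to the set `A` under the map `T`;
by convention it is `0` if the orbit of `x` never returns to `A`. -/
def firstReturn {α : Type*} (T : α → α) (A : Set α) (x : α) : ℕ :=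
  sInf {k : ℕ | 0 < k ∧ T^[k] x ∈ A}

/-- Extended logarithm `ℝ≥0∞ → EReal`. -/
def elog (x : ℝ≥0∞) : EReal :=
  if x = 0 then ⊥ else if x = ⊤ then ⊤ else ((Real.log x.toReal : ℝ) : EReal)

section Generic

variable {α : Type*} [MeasurableSpace α] [PseudoMetricSpace α]

/-- The measure partition function `Γ_μ(ε,q)`. -/
def measPF (μ : Measure α) (ε q : ℝ) : ℝ≥0∞ :=
  ∫⁻ x, μ (Metric.ball x ε) ^ (q - 1) ∂μ

/-- The logarithmic measure partition function `Γ^l_μ(ε)`. -/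
def measPFlog (μ : Measure α) (ε : ℝ) : ℝ :=
  ∫ x, Real.log (μ (Metric.ball x ε)).toReal ∂μ

/-- The return time partition function `Γ_τ(ε,q)`. -/
def retPF (T : α → α) (μ : Measure α) (ε q : ℝ) : ℝ≥0∞ :=
  ∫⁻ x, (firstReturn T (Metric.ball x ε) x : ℝ≥0∞) ^ (1 - q) ∂μ

/-- The logarithmic return time partition function `Γ^l_τ(ε)`. -/
def retPFlog (T : α → α) (μ : Measure α) (ε : ℝ) : ℝ :=
  ∫ x, Real.log ((firstReturn T (Metric.ball x ε) x : ℝ))⁻¹ ∂μ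

/-- The scaling exponent `(1/(q-1)) · log F(ε) / log ε`. -/
def dimScale (F : ℝ → ℝ≥0∞) (q : ℝ) (ε : ℝ) : EReal :=
  ((((q - 1) * Real.log ε)⁻¹ : ℝ) : EReal) * elog (F ε)

/-- Upper generalized dimension obtained from a one-parameter family of partition
functions `F ε`, with the logarithmic convention at `q = 1`. -/
def dimPlus (F : ℝ → ℝ≥0∞) (Flog : ℝ → ℝ) (q : ℝ) : EReal :=
  if q = 1 then ((limsup (fun ε => Flog ε / Real.log ε) (𝓝[>] (0:ℝ)) : ℝ) : EReal)
  else limsup (dimScale F q) (𝓝[>] (0:ℝ))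

/-- Lower generalized dimension. -/
def dimMinus (F : ℝ → ℝ≥0∞) (Flog : ℝ → ℝ) (q : ℝ) : EReal :=
  if q = 1 then ((liminf (fun ε => Flog ε / Real.log ε) (𝓝[>] (0:ℝ)) : ℝ) : EReal)
  else liminf (dimScale F q) (𝓝[>] (0:ℝ))

/-- Generalized measure dimensions `D_μ^+(q)`. -/
def DmuPlus (μ : Measure α) (q : ℝ) : EReal :=
  dimPlus (fun ε => measPF μ ε q) (measPFlog μ) q

/-- Generalized measure dimensions `D_μ^-(q)`. -/
def DmuMinus (μ : Measure α) (q : ℝ) : EReal :=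
  dimMinus (fun ε => measPF μ ε q) (measPFlog μ) q

/-- Return time generalized dimensions `D_τ^+(q)`. -/
def DtauPlus (T : α → α) (μ : Measure α) (q : ℝ) : EReal :=
  dimPlus (fun ε => retPF T μ ε q) (retPFlog T μ) q

/-- Return time generalized dimensions `D_τ^-(q)`. -/
def DtauMinus (T : α → α) (μ : Measure α) (q : ℝ) : EReal :=
  dimMinus (fun ε => retPF T μ ε q) (retPFlog T μ) q

end Generic

/-- Euclidean space `ℝ^n`. -/
abbrev Euc (n : ℕ) := EuclideanSpace ℝ (Fin n)

/-- A grid in `ℝ^n` : a choice of origin and orientation, determining for every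
side length `ε` a partition of `ℝ^n` into half-open cubes of side `ε`. -/
structure Grid (n : ℕ) where
  origin : Euc n
  rot : Euc n ≃ₗᵢ[ℝ] Euc n

/-- Coordinates of a point w.r.t. a grid. -/
def Grid.coords {n : ℕ} (θ : Grid n) (x : Euc n) : Fin n → ℝ :=
  fun i => θ.rot.symm (x - θ.origin) i

/-- The cube `A_j` of side `ε` of the grid `θ`, indexed by `j : Fin n → ℤ`. -/
def Grid.box {n : ℕ} (θ : Grid n) (ε : ℝ) (j : Fin n → ℤ) : Set (Euc n) :=
  {x | ∀ i, (j i : ℝ) * ε ≤ θ.coords x i ∧ θ.coords x i < ((j i : ℝ) + 1) * ε}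

/-- The enlarged cube `Ā_j` of side `3ε` concentric with `A_j`. -/
def Grid.bigBox {n : ℕ} (θ : Grid n) (ε : ℝ) (j : Fin n → ℤ) : Set (Euc n) :=
  {x | ∀ i, ((j i : ℝ) - 1) * ε ≤ θ.coords x i ∧ θ.coords x i < ((j i : ℝ) + 2) * ε}

/-- Box measure partition function `Υ_μ(θ,ε,q) = Σ_{μ(A_j)>0} μ(A_j)^q`. -/
def boxMeasPF {n : ℕ} (μ : Measure (Euc n)) (θ : Grid n) (ε q : ℝ) : ℝ≥0∞ :=
  ∑' j : Fin n → ℤ, if μ (θ.box ε j) = 0 then 0 else μ (θ.box ε j) ^ q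

/-- Logarithmic box measure partition function `Υ^l_μ(θ,ε)`. -/
def boxMeasPFlog {n : ℕ} (μ : Measure (Euc n)) (θ : Grid n) (ε : ℝ) : ℝ :=
  ∑' j : Fin n → ℤ, (μ (θ.box ε j)).toReal * Real.log (μ (θ.box ε j)).toReal

/-- Return time box partition function `Υ_τ(θ,ε,q)`. -/
def boxRetPF {n : ℕ} (T : Euc n → Euc n) (μ : Measure (Euc n)) (θ : Grid n)
    (ε q : ℝ) : ℝ≥0∞ :=
  ∑' j : Fin n → ℤ, ∫⁻ x in θ.box ε j,
    (firstReturn T (θ.box ε j) x : ℝ≥0∞) ^ (1 - q) ∂μ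

/-- Logarithmic return time box partition function `Υ^l_τ(θ,ε)`. -/
def boxRetPFlog {n : ℕ} (T : Euc n → Euc n) (μ : Measure (Euc n)) (θ : Grid n)
    (ε : ℝ) : ℝ :=
  ∑' j : Fin n → ℤ, ∫ x in θ.box ε j,
    Real.log ((firstReturn T (θ.box ε j) x : ℝ))⁻¹ ∂μ

/-- Riedi's enhanced box partition function `Φ_μ(θ,ε,q)`. -/
def riediPF {n : ℕ} (μ : Measure (Euc n)) (θ : Grid n) (ε q : ℝ) : ℝ≥0∞ :=
  ∑' j : Fin n → ℤ, if μ (θ.box ε j) = 0 then 0 else μ (θ.bigBox ε j) ^ q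

/-- The enhanced box partition function `Ψ_μ(θ,ε,q) = Σ_{μ(A_j)>0} μ(A_j) μ(Ā_j)^{q-1}`. -/
def psiMeasPF {n : ℕ} (μ : Measure (Euc n)) (θ : Grid n) (ε q : ℝ) : ℝ≥0∞ :=
  ∑' j : Fin n → ℤ,
    if μ (θ.box ε j) = 0 then 0 else μ (θ.box ε j) * μ (θ.bigBox ε j) ^ (q - 1)

/-- The logarithmic enhanced box partition function `Ψ^l_μ(θ,ε)`. -/
def psiMeasPFlog {n : ℕ} (μ : Measure (Euc n)) (θ : Grid n) (ε : ℝ) : ℝ :=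
  ∑' j : Fin n → ℤ, (μ (θ.box ε j)).toReal * Real.log (μ (θ.bigBox ε j)).toReal

/-- The enhanced return time box partition function `Ψ_τ(θ,ε,q)`:
the integral is over `A_j` but the return is to the enlarged box `Ā_j`. -/
def psiRetPF {n : ℕ} (T : Euc n → Euc n) (μ : Measure (Euc n)) (θ : Grid n)
    (ε q : ℝ) : ℝ≥0∞ :=
  ∑' j : Fin n → ℤ, ∫⁻ x in θ.box ε j,
    (firstReturn T (θ.bigBox ε j) x : ℝ≥0∞) ^ (1 - q) ∂μ

/-- Box measure dimensions `Δ_μ^+(θ,q)`. -/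
def DeltaMuPlus {n : ℕ} (μ : Measure (Euc n)) (θ : Grid n) (q : ℝ) : EReal :=
  dimPlus (fun ε => boxMeasPF μ θ ε q) (boxMeasPFlog μ θ) q

/-- Box measure dimensions `Δ_μ^-(θ,q)`. -/
def DeltaMuMinus {n : ℕ} (μ : Measure (Euc n)) (θ : Grid n) (q : ℝ) : EReal :=
  dimMinus (fun ε => boxMeasPF μ θ ε q) (boxMeasPFlog μ θ) q

/-- Box return time dimensions `Δ_τ^+(θ,q)`. -/
def DeltaTauPlus {n : ℕ} (T : Euc n → Euc n) (μ : Measure (Euc n)) (θ : Grid n)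
    (q : ℝ) : EReal :=
  dimPlus (fun ε => boxRetPF T μ θ ε q) (boxRetPFlog T μ θ) q

/-- Box return time dimensions `Δ_τ^-(θ,q)`. -/
def DeltaTauMinus {n : ℕ} (T : Euc n → Euc n) (μ : Measure (Euc n)) (θ : Grid n)
    (q : ℝ) : EReal :=
  dimMinus (fun ε => boxRetPF T μ θ ε q) (boxRetPFlog T μ θ) q

end

theorem firstReturn_pos {α : Type*} {T : α → α} {A : Set α} {x : α}
    (h : ∃ k, 0 < k ∧ T^[k] x ∈ A) : 0 < firstReturn T A x :=
  (Nat.sInf_mem (s := {k : ℕ | 0 < k ∧ T^[k] x ∈ A}) h).1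

theorem firstReturn_anti {α : Type*} {T : α → α} {A B : Set α} {x : α} (hAB : A ⊆ B)
    (h : ∃ k, 0 < k ∧ T^[k] x ∈ A) : firstReturn T B x ≤ firstReturn T A x := by
  have hA := Nat.sInf_mem (s := {k : ℕ | 0 < k ∧ T^[k] x ∈ A}) h
  exact Nat.sInf_le ⟨hA.1, hAB hA.2⟩

theorem elog_eq_log (x : ℝ≥0∞) : elog x = ENNReal.log x := rfl

/-- Topological Poincaré recurrence: almost every point returns to all balls around it. -/
theorem ae_exists_return_ball {α : Type*} [MeasurableSpace α] [PseudoMetricSpace α]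
    [SecondCountableTopology α] [OpensMeasurableSpace α] {T : α → α} {μ : Measure α}
    (h : Conservative T μ) :
    ∀ᵐ x ∂μ, ∀ ε : ℝ, 0 < ε → ∃ k, 0 < k ∧ T^[k] x ∈ Metric.ball x ε := by
  filter_upwards [h.ae_frequently_mem_of_mem_nhds] with x hx ε hε
  exact (((hx _ (Metric.ball_mem_nhds x hε)).and_eventually (eventually_gt_atTop 0)).exists).imp
    fun k hk => ⟨hk.2, hk.1⟩

namespace Grid

variable {n : ℕ} (θ : Grid n)

theorem continuous_coords (i : Fin n) : Continuous fun x => θ.coords x i := by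
  unfold Grid.coords
  fun_prop

theorem coords_sub (x y : Euc n) (i : Fin n) :
    θ.coords x i - θ.coords y i = θ.rot.symm (x - y) i := by
  have h : x - y = (x - θ.origin) - (y - θ.origin) := by abel
  rw [h, map_sub]
  rfl

theorem measurableSet_box (ε : ℝ) (j : Fin n → ℤ) : MeasurableSet (θ.box ε j) := by
  have h : θ.box ε j = ⋂ i, {x | (j i : ℝ) * ε ≤ θ.coords x i} ∩
      {x | θ.coords x i < ((j i : ℝ) + 1) * ε} := by
    ext x
    simp [Grid.box]
  rw [h]
  exact MeasurableSet.iInter fun i =>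
    (measurableSet_le measurable_const (θ.continuous_coords i).measurable).inter
      (measurableSet_lt (θ.continuous_coords i).measurable measurable_const)

theorem mem_box_iff {ε : ℝ} (hε : 0 < ε) (j : Fin n → ℤ) (x : Euc n) :
    x ∈ θ.box ε j ↔ j = fun i => ⌊θ.coords x i / ε⌋ := by
  simp only [Grid.box, mem_ofPred_eq, funext_iff, eq_comm (a := j _), Int.floor_eq_iff,
    le_div_iff₀ hε, div_lt_iff₀ hε]

theorem pairwise_disjoint_box {ε : ℝ} (hε : 0 < ε) :
    Pairwise (Function.onFun Disjoint (θ.box ε)) := fun j k hjk =>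
  Set.disjoint_left.2 fun x hj hk =>
    hjk (((θ.mem_box_iff hε j x).1 hj).trans ((θ.mem_box_iff hε k x).1 hk).symm)

theorem iUnion_box {ε : ℝ} (hε : 0 < ε) : ⋃ j, θ.box ε j = univ :=
  eq_univ_of_forall fun x => mem_iUnion.2 ⟨_, (θ.mem_box_iff hε _ x).2 rfl⟩

theorem tsum_setLIntegral_box (μ : Measure (Euc n)) {ε : ℝ} (hε : 0 < ε) (f : Euc n → ℝ≥0∞) :
    ∑' j, ∫⁻ x in θ.box ε j, f x ∂μ = ∫⁻ x, f x ∂μ := by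
  rw [← lintegral_iUnion (θ.measurableSet_box ε) (θ.pairwise_disjoint_box hε), θ.iUnion_box hε,
    setLIntegral_univ]

theorem ball_subset_bigBox {ε : ℝ} {j : Fin n → ℤ} {x : Euc n} (hx : x ∈ θ.box ε j) :
    Metric.ball x ε ⊆ θ.bigBox ε j := by
  intro y hy i
  have h : |θ.coords y i - θ.coords x i| < ε := by
    rw [θ.coords_sub]
    refine (PiLp.norm_apply_le (θ.rot.symm (y - x)) i).trans_lt ?_
    rwa [LinearIsometryEquiv.norm_map, ← dist_eq_norm]
  have hxi := hx i
  rw [abs_lt] at h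
  constructor <;> linarith

theorem bigBox_subset_ball {ε : ℝ} (hε : 0 < ε) {j : Fin n → ℤ} {x : Euc n}
    (hx : x ∈ θ.box ε j) : θ.bigBox ε j ⊆ Metric.ball x ((2 * √n + 1) * ε) := by
  intro y hy
  have h : ∀ i, θ.rot.symm (y - x) i ^ 2 ≤ (2 * ε) ^ 2 := by
    intro i
    rw [← θ.coords_sub]
    have hxi := hx i
    have hyi := hy i
    exact sq_le_sq' (by linarith) (by linarith)
  have hnorm : ‖y - x‖ ^ 2 ≤ (2 * √n * ε) ^ 2 := by
    rw [← LinearIsometryEquiv.norm_map θ.rot.symm, EuclideanSpace.real_norm_sq_eq]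
    calc ∑ i, θ.rot.symm (y - x) i ^ 2 ≤ ∑ _i : Fin n, (2 * ε) ^ 2 :=
          Finset.sum_le_sum fun i _ => h i
      _ = (2 * √n * ε) ^ 2 := by
        rw [Finset.sum_const, Finset.card_univ, Fintype.card_fin, nsmul_eq_mul, mul_pow, mul_pow,
          mul_pow, Real.sq_sqrt n.cast_nonneg]
        ring
  have := le_of_sq_le_sq hnorm (by positivity)
  rw [Metric.mem_ball, dist_eq_norm]
  linarith

end Grid

/-- Almost surely, the return time to the enlarged box of a point lies between its return times
to balls of comparable radii. -/
theorem ae_firstReturn_bigBox_bounds {n : ℕ} {T : Euc n → Euc n} {μ : Measure (Euc n)}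
    (h : Conservative T μ) (θ : Grid n) {ε : ℝ} (hε : 0 < ε) :
    ∀ᵐ x ∂μ, ∀ j, x ∈ θ.box ε j →
      firstReturn T (Metric.ball x ((2 * √n + 1) * ε)) x ≤ firstReturn T (θ.bigBox ε j) x ∧
      firstReturn T (θ.bigBox ε j) x ≤ firstReturn T (Metric.ball x ε) x := by
  filter_upwards [ae_exists_return_ball h] with x hx j hj
  have hbox : ∃ k, 0 < k ∧ T^[k] x ∈ θ.bigBox ε j :=
    (hx ε hε).imp fun k hk => ⟨hk.1, θ.ball_subset_bigBox hj hk.2⟩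
  exact ⟨firstReturn_anti (θ.bigBox_subset_ball hε hj) hbox,
    firstReturn_anti (θ.ball_subset_bigBox hj) (hx ε hε)⟩

theorem psiRetPF_bounds_of_lt_one {n : ℕ} {T : Euc n → Euc n} {μ : Measure (Euc n)}
    (h : Conservative T μ) (θ : Grid n) {ε q : ℝ} (hε : 0 < ε) (hq : q < 1) :
    retPF T μ ((2 * √n + 1) * ε) q ≤ psiRetPF T μ θ ε q ∧
      psiRetPF T μ θ ε q ≤ retPF T μ ε q := by
  have hae := ae_firstReturn_bigBox_bounds h θ hε
  have hq' : 0 ≤ 1 - q := by linarith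
  constructor <;> rw [retPF, ← θ.tsum_setLIntegral_box μ hε] <;>
    refine ENNReal.tsum_le_tsum fun j => setLIntegral_mono_ae' (θ.measurableSet_box ε j) ?_ <;>
    filter_upwards [hae] with x hx hxj
  · exact ENNReal.rpow_le_rpow (Nat.cast_le.2 (hx j hxj).1) hq'
  · exact ENNReal.rpow_le_rpow (Nat.cast_le.2 (hx j hxj).2) hq'

theorem ennreal_rpow_le_rpow_of_nonpos {x y : ℝ≥0∞} {z : ℝ} (hz : z ≤ 0) (h : x ≤ y) :
    y ^ z ≤ x ^ z := by
  rw [← neg_neg z, ENNReal.rpow_neg y, ENNReal.rpow_neg x, ENNReal.inv_le_inv]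
  exact ENNReal.rpow_le_rpow h (neg_nonneg.2 hz)

theorem psiRetPF_bounds_of_one_lt {n : ℕ} {T : Euc n → Euc n} {μ : Measure (Euc n)}
    (h : Conservative T μ) (θ : Grid n) {ε q : ℝ} (hε : 0 < ε) (hq : 1 < q) :
    retPF T μ ε q ≤ psiRetPF T μ θ ε q ∧
      psiRetPF T μ θ ε q ≤ retPF T μ ((2 * √n + 1) * ε) q := by
  have hae := ae_firstReturn_bigBox_bounds h θ hε
  have hq' : 1 - q ≤ 0 := by linarith
  constructor <;> rw [retPF, ← θ.tsum_setLIntegral_box μ hε] <;>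
    refine ENNReal.tsum_le_tsum fun j => setLIntegral_mono_ae' (θ.measurableSet_box ε j) ?_ <;>
    filter_upwards [hae] with x hx hxj
  · exact ennreal_rpow_le_rpow_of_nonpos hq' (Nat.cast_le.2 (hx j hxj).2)
  · exact ennreal_rpow_le_rpow_of_nonpos hq' (Nat.cast_le.2 (hx j hxj).1)

theorem one_le_retPF_of_lt_one {α : Type*} [MeasurableSpace α] [PseudoMetricSpace α]
    [SecondCountableTopology α] [OpensMeasurableSpace α] {T : α → α} {μ : Measure α}
    [IsProbabilityMeasure μ] (h : Conservative T μ) {ε q : ℝ} (hε : 0 < ε) (hq : q < 1) :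
    1 ≤ retPF T μ ε q := by
  calc (1 : ℝ≥0∞) = ∫⁻ _x, 1 ∂μ := by simp
    _ ≤ retPF T μ ε q := by
      refine lintegral_mono_ae ?_
      filter_upwards [ae_exists_return_ball h] with x hx
      exact ENNReal.one_le_rpow (Nat.one_le_cast.2 (firstReturn_pos (hx ε hε))) (by linarith)

theorem retPF_le_one_of_one_lt {α : Type*} [MeasurableSpace α] [PseudoMetricSpace α]
    [SecondCountableTopology α] [OpensMeasurableSpace α] {T : α → α} {μ : Measure α}
    [IsProbabilityMeasure μ] (h : Conservative T μ) {ε q : ℝ} (hε : 0 < ε) (hq : 1 < q) :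
    retPF T μ ε q ≤ 1 := by
  calc retPF T μ ε q ≤ ∫⁻ _x, 1 ∂μ := by
        refine lintegral_mono_ae ?_
        filter_upwards [ae_exists_return_ball h] with x hx
        exact ENNReal.rpow_le_one_of_one_le_of_neg
          (Nat.one_le_cast.2 (firstReturn_pos (hx ε hε))) (by linarith)
    _ = 1 := by simp

theorem dimScale_le_of_lt_one {F G : ℝ → ℝ≥0∞} {q ε : ℝ} (hq : q < 1) (hε : 0 < ε) (hε1 : ε < 1)
    (h : F ε ≤ G ε) : dimScale F q ε ≤ dimScale G q ε := by
  have hc : 0 ≤ ((q - 1) * Real.log ε)⁻¹ :=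
    inv_nonneg.2 (mul_nonneg_of_nonpos_of_nonpos (by linarith) (Real.log_neg hε hε1).le)
  exact mul_le_mul_of_nonneg_left (ENNReal.log_monotone h) (EReal.coe_nonneg.2 hc)

theorem dimScale_le_of_one_lt {F G : ℝ → ℝ≥0∞} {q ε : ℝ} (hq : 1 < q) (hε : 0 < ε) (hε1 : ε < 1)
    (h : F ε ≤ G ε) : dimScale G q ε ≤ dimScale F q ε := by
  have hc : 0 ≤ -((q - 1) * Real.log ε)⁻¹ := by
    rw [← inv_neg, inv_nonneg, ← mul_neg]
    exact mul_nonneg (by linarith) (neg_nonneg.2 (Real.log_neg hε hε1).le)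
  have := mul_le_mul_of_nonneg_left (ENNReal.log_monotone h) (EReal.coe_nonneg.2 hc)
  rwa [EReal.coe_neg, EReal.neg_mul, EReal.neg_mul, EReal.neg_le_neg_iff] at this

theorem dimScale_one (q ε : ℝ) : dimScale (fun _ => 1) q ε = 0 := by
  simp [dimScale, elog_eq_log]

theorem dimScale_comp_mul_left (F : ℝ → ℝ≥0∞) (q : ℝ) {c ε : ℝ} (h : Real.log (c * ε) ≠ 0) :
    dimScale (fun δ => F (c * δ)) q ε =
      ((Real.log (c * ε) / Real.log ε : ℝ) : EReal) * dimScale F q (c * ε) := by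
  rw [dimScale, dimScale, ← mul_assoc, ← EReal.coe_mul]
  congr 2
  rw [mul_inv, mul_inv]
  field_simp

theorem map_mul_left_nhdsGT_zero {c : ℝ} (hc : 0 < c) :
    map (c * ·) (𝓝[>] (0 : ℝ)) = 𝓝[>] 0 := by
  conv_lhs => rw [← comap_mulLeft_nhdsGT_zero hc]
  exact map_comap_of_surjective (mul_left_surjective₀ hc.ne') _

theorem tendsto_log_mul_div_log {c : ℝ} (hc : 0 < c) :
    Tendsto (fun ε => Real.log (c * ε) / Real.log ε) (𝓝[>] 0) (𝓝 1) := by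
  have hlog := Real.tendsto_log_nhdsGT_zero
  have h : Tendsto (fun ε => Real.log c / Real.log ε + 1) (𝓝[>] 0) (𝓝 (0 + 1)) :=
    (hlog.const_div_atBot _).add_const 1
  rw [zero_add] at h
  refine h.congr' ?_
  filter_upwards [self_mem_nhdsWithin, hlog.eventually (eventually_lt_atBot 0)] with ε hε hneg
  rw [Real.log_mul hc.ne' (ne_of_gt hε), add_div, div_self hneg.ne]

section Limits

variable {ι : Type*} {l : Filter ι} [l.NeBot] {u v : ι → EReal}

theorem limsup_mul_of_tendsto_one (hu : Tendsto u l (𝓝 1)) (hv : 0 ≤ᶠ[l] v) :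
    limsup (u * v) l = limsup v l := by
  have hu0 : 0 ≤ᶠ[l] u := (hu.eventually (lt_mem_nhds zero_lt_one)).mono fun _ h => h.le
  apply le_antisymm
  · refine (EReal.limsup_mul_le hu0.frequently hv ?_ ?_).trans ?_ <;> simp [hu.limsup_eq]
    exact Or.inl (EReal.coe_ne_top 1)
  · rw [mul_comm]
    refine le_trans ?_ (EReal.le_limsup_mul hv.frequently hu0)
    simp [hu.liminf_eq]

theorem liminf_mul_of_tendsto_one (hu : Tendsto u l (𝓝 1)) (hv : 0 ≤ᶠ[l] v) :
    liminf (u * v) l = liminf v l := by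
  have hu0 : 0 ≤ᶠ[l] u := (hu.eventually (lt_mem_nhds zero_lt_one)).mono fun _ h => h.le
  apply le_antisymm
  · refine (EReal.liminf_mul_le hu0 hv ?_ ?_).trans ?_ <;> simp [hu.limsup_eq]
    exact Or.inl (EReal.coe_ne_top 1)
  · refine le_trans ?_ (EReal.le_liminf_mul hu0 hv)
    simp [hu.liminf_eq]

end Limits

/-- Rescaling the radius by a constant does not change the scaling exponents. -/
theorem limsup_liminf_dimScale_comp_mul_left {F : ℝ → ℝ≥0∞} {q c : ℝ} (hc : 0 < c)
    (hF : 0 ≤ᶠ[𝓝[>] 0] dimScale F q) :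
    limsup (dimScale (fun ε => F (c * ε)) q) (𝓝[>] 0) = limsup (dimScale F q) (𝓝[>] 0) ∧
      liminf (dimScale (fun ε => F (c * ε)) q) (𝓝[>] 0) = liminf (dimScale F q) (𝓝[>] 0) := by
  have hmap := map_mul_left_nhdsGT_zero hc
  have hlog : Tendsto (fun ε => Real.log (c * ε)) (𝓝[>] 0) atBot :=
    Real.tendsto_log_nhdsGT_zero.comp hmap.le
  have heq : dimScale (fun ε => F (c * ε)) q =ᶠ[𝓝[>] 0]
      (fun ε => ((Real.log (c * ε) / Real.log ε : ℝ) : EReal)) * (dimScale F q ∘ (c * ·)) := by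
    filter_upwards [hlog.eventually (eventually_lt_atBot 0)] with ε hε
    exact dimScale_comp_mul_left F q hε.ne
  have hone : Tendsto (fun ε => ((Real.log (c * ε) / Real.log ε : ℝ) : EReal)) (𝓝[>] 0) (𝓝 1) :=
    (continuous_coe_real_ereal.tendsto 1).comp (tendsto_log_mul_div_log hc)
  have hF' : 0 ≤ᶠ[𝓝[>] 0] dimScale F q ∘ (c * ·) := eventually_nhdsGT_zero_mul_left hc hF
  constructor
  · rw [limsup_congr heq, limsup_mul_of_tendsto_one hone hF', limsup_comp, hmap]
  · rw [liminf_congr heq, liminf_mul_of_tendsto_one hone hF', liminf_comp, hmap]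

/-- For an ergodic dynamical system, for every grid `θ` and every `q ≠ 1`,
the scaling exponents of the enhanced return time box partition function `Ψ_τ(θ,ε,q)`
coincide with the generalized return time dimensions `D_τ^±(q)`, independently of `θ`. -/
theorem psi_return_box_dimensions_eq_generalized {n : ℕ} (T : Euc n → Euc n)
    (μ : Measure (Euc n)) [IsProbabilityMeasure μ] (X : Set (Euc n))
    (hXc : IsCompact X) (hX1 : μ X = 1) (hTX : Set.MapsTo T X X)
    (hErg : Ergodic T μ) :
    ∀ (θ : Grid n) (q : ℝ), q ≠ 1 →
      Filter.limsup (dimScale (fun ε => psiRetPF T μ θ ε q) q) (𝓝[>] (0:ℝ)) =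
          DtauPlus T μ q ∧
        Filter.liminf (dimScale (fun ε => psiRetPF T μ θ ε q) q) (𝓝[>] (0:ℝ)) =
          DtauMinus T μ q := by
  intro θ q hq
  have hcons := hErg.toMeasurePreserving.conservative
  have hc : 0 < 2 * √n + 1 := by positivity
  have hsmall : ∀ᶠ ε : ℝ in 𝓝[>] 0, 0 < ε ∧ ε < 1 := Ioo_mem_nhdsGT zero_lt_one
  have key : ∀ᶠ ε in 𝓝[>] (0 : ℝ), 0 ≤ dimScale (fun ε => retPF T μ ε q) q ε ∧
      dimScale (fun ε => retPF T μ ((2 * √n + 1) * ε) q) q ε ≤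
        dimScale (fun ε => psiRetPF T μ θ ε q) q ε ∧
      dimScale (fun ε => psiRetPF T μ θ ε q) q ε ≤ dimScale (fun ε => retPF T μ ε q) q ε := by
    filter_upwards [hsmall] with ε ⟨hε, hε1⟩
    rw [← dimScale_one q ε]
    rcases lt_or_gt_of_ne hq with hq | hq
    · have hb := psiRetPF_bounds_of_lt_one hcons θ hε hq
      exact ⟨dimScale_le_of_lt_one hq hε hε1 (one_le_retPF_of_lt_one hcons hε hq),
        dimScale_le_of_lt_one hq hε hε1 hb.1, dimScale_le_of_lt_one hq hε hε1 hb.2⟩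
    · have hb := psiRetPF_bounds_of_one_lt hcons θ hε hq
      exact ⟨dimScale_le_of_one_lt hq hε hε1 (retPF_le_one_of_one_lt hcons hε hq),
        dimScale_le_of_one_lt hq hε hε1 hb.2, dimScale_le_of_one_lt hq hε hε1 hb.1⟩
  have hscale := limsup_liminf_dimScale_comp_mul_left (F := fun ε => retPF T μ ε q) hc
    (key.mono fun _ h => h.1)
  rw [DtauPlus, DtauMinus, dimPlus, dimMinus, if_neg hq, if_neg hq]
  exact ⟨le_antisymm (limsup_le_limsup (key.mono fun _ h => h.2.2))
      (hscale.1.ge.trans (limsup_le_limsup (key.mono fun _ h => h.2.1))),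
    le_antisymm (liminf_le_liminf (key.mono fun _ h => h.2.2))
      (hscale.2.ge.trans (liminf_le_liminf (key.mono fun _ h => h.2.1)))⟩
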